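/- Let n ∈ ℕ, let (Y, ‖·‖_Y) be a Banach space, and fix p ∈ [1,∞), q > 0 and x ∈ ℝⁿ. Every measurable function f : ℝⁿ → Y satisfies ∫_0^∞ ∫_{B^n} ‖f^x(uy) − P⁰_u f^x‖_Y^p / u^{q+1} dy du ≤ (2^p/(n+q)) ∫_{ℝⁿ} ‖f(x+y) − f(x)‖_Y^p / ‖y‖_2^{n+q} dy. -/

import Mathlib

open MeasureTheory

/-- The volume of the Euclidean unit ball in `ℝⁿ`. -/
noncomputable def Vball (n : ℕ) : ℝ :=
  (volume (Metric.ball (0 : EuclideanSpace ℝ (Fin n)) 1)).toReal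

/-- The mean `P⁰_u f = (1/V_n) ∫_{B^n} f(uz) dz`. -/
noncomputable def P0 (n : ℕ) {Y : Type*} [NormedAddCommGroup Y] [NormedSpace ℝ Y]
    (u : ℝ) (f : EuclideanSpace ℝ (Fin n) → Y) : Y :=
  (Vball n)⁻¹ • ∫ z in Metric.ball (0 : EuclideanSpace ℝ (Fin n)) 1, f (u • z)


lemma aux_jensen {E : Type*} [MeasurableSpace E] {Y : Type*} [NormedAddCommGroup Y]
    [NormedSpace ℝ Y] [CompleteSpace Y] (ν : Measure E) [IsProbabilityMeasure ν]
    (p : ℝ) (hp : 1 ≤ p) (h : E → Y) (hh : AEStronglyMeasurable h ν) (a : Y) :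
    ∫⁻ y, ‖h y - ∫ z, h z ∂ν‖ₑ ^ p ∂ν ≤ 2 ^ p * ∫⁻ y, ‖h y - a‖ₑ ^ p ∂ν := by
  have hp0 : 0 < p := by linarith
  have hg : AEStronglyMeasurable (fun y => h y - a) ν := hh.sub aestronglyMeasurable_const
  have hJ : (∫⁻ y, ‖h y - a‖ₑ ∂ν) ^ p ≤ ∫⁻ y, ‖h y - a‖ₑ ^ p ∂ν := by
    have h1 := eLpNorm'_le_eLpNorm'_of_exponent_le (μ := ν) zero_lt_one hp hg
    simp only [eLpNorm', ENNReal.rpow_one, div_one] at h1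
    calc _ ≤ ((∫⁻ y, ‖h y - a‖ₑ ^ p ∂ν) ^ (1 / p)) ^ p := by gcongr
      _ = _ := by rw [← ENNReal.rpow_mul, one_div_mul_cancel hp0.ne', ENNReal.rpow_one]
  by_cases htop : ∫⁻ y, ‖h y - a‖ₑ ^ p ∂ν = ⊤
  · rw [htop, ENNReal.mul_top (by simp [hp0.not_gt])]
    exact le_top
  have hint : Integrable (fun y => h y - a) ν := by
    refine ⟨hg, ?_⟩
    rw [hasFiniteIntegral_iff_enorm]
    by_contra hc
    rw [not_lt, top_le_iff] at hc
    rw [hc, ENNReal.top_rpow_of_pos hp0, top_le_iff] at hJ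
    exact htop hJ
  have hinth : Integrable h ν := by
    have := hint.add (integrable_const a)
    refine this.congr (Filter.Eventually.of_forall fun y => by simp)
  have hc : a - ∫ z, h z ∂ν = - ∫ z, (h z - a) ∂ν := by
    rw [integral_sub hinth (integrable_const a)]; simp
  have hcb : ‖a - ∫ z, h z ∂ν‖ₑ ^ p ≤ ∫⁻ y, ‖h y - a‖ₑ ^ p ∂ν := by
    rw [hc, enorm_neg]
    exact (ENNReal.rpow_le_rpow (enorm_integral_le_lintegral_enorm _) hp0.le).trans hJ
  calc ∫⁻ y, ‖h y - ∫ z, h z ∂ν‖ₑ ^ p ∂ν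
      ≤ ∫⁻ y, 2 ^ (p - 1) * (‖h y - a‖ₑ ^ p + ‖a - ∫ z, h z ∂ν‖ₑ ^ p) ∂ν := by
        refine lintegral_mono fun y => ?_
        refine le_trans ?_ (ENNReal.rpow_add_le_mul_rpow_add_rpow _ _ hp)
        gcongr
        rw [← sub_add_sub_cancel (h y) a]
        exact enorm_add_le _ _
    _ = 2 ^ (p - 1) * ((∫⁻ y, ‖h y - a‖ₑ ^ p ∂ν) + ‖a - ∫ z, h z ∂ν‖ₑ ^ p) := by
        rw [lintegral_const_mul' _ _ (by simp), lintegral_add_right _ measurable_const]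
        simp
    _ ≤ 2 ^ (p - 1) * ((∫⁻ y, ‖h y - a‖ₑ ^ p ∂ν) + ∫⁻ y, ‖h y - a‖ₑ ^ p ∂ν) := by gcongr
    _ = 2 ^ p * ∫⁻ y, ‖h y - a‖ₑ ^ p ∂ν := by
        rw [← two_mul, ← mul_assoc]
        congr 1
        conv_lhs => rw [← ENNReal.rpow_one 2, ← ENNReal.rpow_mul, one_mul]
        rw [← ENNReal.rpow_add _ _ (by simp) (by simp)]
        simp

lemma aux_ball {n : ℕ} {Y : Type*} [NormedAddCommGroup Y]
    [NormedSpace ℝ Y] [CompleteSpace Y]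
    (p : ℝ) (hp : 1 ≤ p) (h : EuclideanSpace ℝ (Fin n) → Y) (hh : StronglyMeasurable h) (a : Y) :
    ∫⁻ y in Metric.ball (0 : EuclideanSpace ℝ (Fin n)) 1,
      ‖h y - (Vball n)⁻¹ • ∫ z in Metric.ball (0 : EuclideanSpace ℝ (Fin n)) 1, h z‖ₑ ^ p
      ≤ 2 ^ p * ∫⁻ y in Metric.ball (0 : EuclideanSpace ℝ (Fin n)) 1, ‖h y - a‖ₑ ^ p := by
  set B := Metric.ball (0 : EuclideanSpace ℝ (Fin n)) 1 with hB
  have hB0 : volume B ≠ 0 := (Metric.measure_ball_pos volume _ one_pos).ne'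
  have hBt : volume B ≠ ⊤ := measure_ball_lt_top.ne
  let ν : Measure (EuclideanSpace ℝ (Fin n)) := (volume B)⁻¹ • volume.restrict B
  have : IsProbabilityMeasure ν := ⟨by simp [ν, ENNReal.inv_mul_cancel hB0 hBt]⟩
  have hJ := aux_jensen ν p hp h hh.aestronglyMeasurable a
  have hm : ∫ z, h z ∂ν = (Vball n)⁻¹ • ∫ z in B, h z := by
    simp [ν, integral_smul_measure, Vball, hB]
  rw [hm] at hJ
  simp only [ν, lintegral_smul_measure, smul_eq_mul] at hJ
  rw [mul_left_comm] at hJ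
  exact (ENNReal.mul_le_mul_iff_right (ENNReal.inv_ne_zero.2 hBt) (ENNReal.inv_ne_top.2 hB0)).1 hJ

lemma aux_scale {n : ℕ} (u : ℝ) (hu : 0 < u) (G : EuclideanSpace ℝ (Fin n) → ENNReal)
    (hG : Measurable G) :
    ∫⁻ y in Metric.ball (0 : EuclideanSpace ℝ (Fin n)) 1, G (u • y) =
      ENNReal.ofReal ((u ^ n)⁻¹) * ∫⁻ y, (Metric.ball 0 u).indicator G y := by
  have h1 := Measure.map_addHaar_smul (volume : Measure (EuclideanSpace ℝ (Fin n))) hu.ne'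
  have h2 : Measurable ((Metric.ball 0 u).indicator G) := hG.indicator measurableSet_ball
  have h3 : ∫⁻ y, (Metric.ball 0 u).indicator G y
      ∂(Measure.map (u • ·) (volume : Measure (EuclideanSpace ℝ (Fin n)))) =
      ∫⁻ y, (Metric.ball 0 u).indicator G (u • y) :=
    lintegral_map h2 (measurable_const_smul u)
  rw [h1, lintegral_smul_measure] at h3
  have h4 : |(u ^ n)⁻¹| = (u ^ n)⁻¹ := abs_of_pos (by positivity)
  simp only [finrank_euclideanSpace, Fintype.card_fin, h4, smul_eq_mul] at h3
  rw [h3, ← lintegral_indicator measurableSet_ball]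
  congr 1 with y
  have : u • y ∈ Metric.ball (0 : EuclideanSpace ℝ (Fin n)) u ↔ y ∈ Metric.ball 0 1 := by
    simp only [Metric.mem_ball, dist_zero_right, norm_smul, Real.norm_eq_abs, abs_of_pos hu]
    exact mul_lt_iff_lt_one_right hu
  by_cases hy : y ∈ Metric.ball (0 : EuclideanSpace ℝ (Fin n)) 1
  · rw [Set.indicator_of_mem hy, Set.indicator_of_mem (this.2 hy)]
  · rw [Set.indicator_of_notMem hy, Set.indicator_of_notMem (fun h => hy (this.1 h))]

lemma aux_tail (c s : ℝ) (hc : 0 < c) (hs : 0 < s) :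
    ∫⁻ u in Set.Ioi c, ENNReal.ofReal (u ^ (-(s + 1))) =
      ENNReal.ofReal (1 / s) * ENNReal.ofReal (1 / c ^ s) := by
  rw [← ofReal_integral_eq_lintegral_ofReal (integrableOn_Ioi_rpow_of_lt (by linarith) hc),
    integral_Ioi_rpow_of_lt (by linarith) hc, ← ENNReal.ofReal_mul (by positivity)]
  · congr 1
    rw [show -(s + 1) + 1 = -s by ring, Real.rpow_neg hc.le]
    field_simp
  · filter_upwards [ae_restrict_mem measurableSet_Ioi] with u hu
    exact Real.rpow_nonneg (hc.trans hu).le _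

lemma aux_tonelli {n : ℕ} (q : ℝ) (hq : 0 < q) (G : EuclideanSpace ℝ (Fin n) → ENNReal)
    (hG : Measurable G) (hG0 : G 0 = 0) :
    ∫⁻ u in Set.Ioi (0 : ℝ), ENNReal.ofReal (1 / u ^ (q + 1)) *
        ∫⁻ y in Metric.ball (0 : EuclideanSpace ℝ (Fin n)) 1, G (u • y) =
      ENNReal.ofReal (1 / ((n : ℝ) + q)) *
        ∫⁻ y, G y * ENNReal.ofReal (1 / ‖y‖ ^ ((n : ℝ) + q)) := by
  have hs : 0 < (n : ℝ) + q := by positivity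
  have hms : MeasurableSet {w : ℝ × EuclideanSpace ℝ (Fin n) | ‖w.2‖ < w.1} :=
    measurableSet_lt (by fun_prop) (by fun_prop)
  let K : ℝ × EuclideanSpace ℝ (Fin n) → ENNReal :=
    {w : ℝ × EuclideanSpace ℝ (Fin n) | ‖w.2‖ < w.1}.indicator
      (fun w => ENNReal.ofReal (w.1 ^ (-((n : ℝ) + q + 1))) * G w.2)
  have hK : Measurable K := by
    refine Measurable.indicator ?_ hms
    exact ((measurable_fst.pow_const _).ennreal_ofReal).mul (hG.comp measurable_snd)
  calc _ = ∫⁻ u in Set.Ioi (0 : ℝ), ∫⁻ y, K (u, y) := by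
        refine setLIntegral_congr_fun measurableSet_Ioi fun u hu => ?_
        have hu : 0 < u := hu
        rw [aux_scale u hu G hG, ← mul_assoc, ← ENNReal.ofReal_mul (by positivity),
          ← lintegral_const_mul _ (hG.indicator measurableSet_ball)]
        refine lintegral_congr fun y => ?_
        have hpow : 1 / u ^ (q + 1) * (u ^ n)⁻¹ = u ^ (-((n : ℝ) + q + 1)) := by
          rw [Real.rpow_neg hu.le, show (n : ℝ) + q + 1 = (q + 1) + n by ring,
            Real.rpow_add hu (q + 1) n, Real.rpow_natCast, mul_inv, one_div]
        rw [hpow]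
        by_cases hy : ‖y‖ < u
        · simp [K, Set.indicator, hy]
        · simp [K, Set.indicator, hy]
    _ = ∫⁻ y, ∫⁻ u in Set.Ioi (0 : ℝ), K (u, y) :=
        lintegral_lintegral_swap hK.aemeasurable
    _ = ∫⁻ y, ENNReal.ofReal (1 / ((n : ℝ) + q)) *
          (G y * ENNReal.ofReal (1 / ‖y‖ ^ ((n : ℝ) + q))) := by
        refine lintegral_congr fun y => ?_
        by_cases hy : y = 0
        · subst hy
          simp [K, Set.indicator, hG0]
        have hy0 : 0 < ‖y‖ := norm_pos_iff.2 hy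
        have : ∀ u, K (u, y) = (Set.Ioi ‖y‖).indicator
            (fun u => G y * ENNReal.ofReal (u ^ (-((n : ℝ) + q + 1)))) u := by
          intro u
          by_cases h : ‖y‖ < u
          · simp [K, Set.indicator, h, mul_comm]
          · simp [K, Set.indicator, h]
        simp_rw [this]
        rw [setLIntegral_indicator measurableSet_Ioi,
          Set.inter_eq_left.2 (Set.Ioi_subset_Ioi hy0.le), lintegral_const_mul _ (by fun_prop),
          aux_tail _ _ hy0 hs]
        ring
    _ = _ := by
        rw [lintegral_const_mul]
        exact hG.mul (by fun_prop)

/-- **Lemma 2.3.** For `p ∈ [1,∞)`, `q > 0` and `x ∈ ℝⁿ`, every measurable `f : ℝⁿ → Y`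
satisfies
`∫_0^∞ ∫_{B^n} ‖f^x(uy) - P⁰_u f^x‖^p / u^{q+1} dy du
  ≤ (2^p/(n+q)) ∫_{ℝⁿ} ‖f(x+y) - f(x)‖^p / ‖y‖₂^{n+q} dy`. -/
theorem mean_approx_bound (n : ℕ) (Y : Type*) [NormedAddCommGroup Y] [NormedSpace ℝ Y]
    [CompleteSpace Y] (p q : ℝ) (hp : 1 ≤ p) (hq : 0 < q)
    (x : EuclideanSpace ℝ (Fin n)) (f : EuclideanSpace ℝ (Fin n) → Y)
    (hf : StronglyMeasurable f) :
    (∫⁻ u in Set.Ioi (0 : ℝ), ∫⁻ y in Metric.ball (0 : EuclideanSpace ℝ (Fin n)) 1,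
        ENNReal.ofReal (‖f (x + u • y) - P0 n u (fun z => f (x + z))‖ ^ p / u ^ (q + 1))) ≤
      ENNReal.ofReal (2 ^ p / ((n : ℝ) + q)) *
        ∫⁻ y, ENNReal.ofReal (‖f (x + y) - f x‖ ^ p / ‖y‖ ^ ((n : ℝ) + q)) := by
  have hp0 : 0 < p := by linarith
  have key : ∀ (v : Y) (r : ℝ), 0 ≤ r →
      ENNReal.ofReal (‖v‖ ^ p / r) = ‖v‖ₑ ^ p * ENNReal.ofReal (1 / r) := by
    intro v r hr
    rw [div_eq_mul_one_div, ENNReal.ofReal_mul (by positivity),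
      ← ENNReal.ofReal_rpow_of_nonneg (norm_nonneg _) hp0.le, ofReal_norm]
  let G : EuclideanSpace ℝ (Fin n) → ENNReal := fun y => ‖f (x + y) - f x‖ₑ ^ p
  have hfx : StronglyMeasurable fun y => f (x + y) :=
    hf.comp_measurable (measurable_const_add x)
  have hG : Measurable G :=
    ((hfx.sub stronglyMeasurable_const).enorm).pow_const p
  have hG0 : G 0 = 0 := by simp [G, hp0]
  have hR : ∫⁻ y, ENNReal.ofReal (‖f (x + y) - f x‖ ^ p / ‖y‖ ^ ((n : ℝ) + q)) =
      ∫⁻ y, G y * ENNReal.ofReal (1 / ‖y‖ ^ ((n : ℝ) + q)) :=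
    lintegral_congr fun y => key _ _ (by positivity)
  have h2p : ENNReal.ofReal (2 ^ p / ((n : ℝ) + q)) =
      2 ^ p * ENNReal.ofReal (1 / ((n : ℝ) + q)) := by
    rw [div_eq_mul_one_div, ENNReal.ofReal_mul (by positivity),
      ← ENNReal.ofReal_rpow_of_nonneg (by norm_num) hp0.le]
    simp
  rw [hR, h2p, mul_assoc, ← aux_tonelli q hq G hG hG0, ← lintegral_const_mul' _ _ (by simp)]
  refine setLIntegral_mono' measurableSet_Ioi fun u hu => ?_
  have hu : 0 < u := hu
  have hh : StronglyMeasurable fun y => f (x + u • y) :=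
    hfx.comp_measurable (measurable_const_smul u)
  have hb := aux_ball p hp (fun y => f (x + u • y)) hh (f x)
  calc _ = ∫⁻ y in Metric.ball (0 : EuclideanSpace ℝ (Fin n)) 1,
        ‖f (x + u • y) - P0 n u (fun z => f (x + z))‖ₑ ^ p * ENNReal.ofReal (1 / u ^ (q + 1)) :=
        lintegral_congr fun y => key _ _ (by positivity)
    _ = (∫⁻ y in Metric.ball (0 : EuclideanSpace ℝ (Fin n)) 1,
        ‖f (x + u • y) - P0 n u (fun z => f (x + z))‖ₑ ^ p) * ENNReal.ofReal (1 / u ^ (q + 1)) :=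
        lintegral_mul_const' _ _ (by simp)
    _ ≤ (2 ^ p * ∫⁻ y in Metric.ball (0 : EuclideanSpace ℝ (Fin n)) 1, G (u • y)) *
          ENNReal.ofReal (1 / u ^ (q + 1)) := by
        gcongr
        exact hb
    _ = _ := by ring
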